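/- Let A be a commutative ring, B an A-algebra, and A' an A-algebra which is flat as an A-module. Set B' = A' ⊗_A B, viewed as an A'-algebra and as a B-algebra. Then there is a B'-module isomorphism H¹(L_{B'/A'}) ≅ B' ⊗_B H¹(L_{B/A}), i.e. the first André–Quillen homology commutes with flat base change. -/

import Mathlib

open TensorProduct

attribute [local instance] Algebra.TensorProduct.rightAlgebra

/-- Flat base change for the first André–Quillen homology: if `A'` is a flat `A`-algebra
and `B' = A' ⊗[A] B`, then `H¹(L_{B'/A'}) ≅ B' ⊗[B] H¹(L_{B/A})` as `B'`-modules. -/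
theorem h1Cotangent_flat_baseChange
    (A : Type*) [CommRing A] (B : Type*) [CommRing B] [Algebra A B]
    (A' : Type*) [CommRing A'] [Algebra A A'] [Module.Flat A A'] :
    Nonempty (Algebra.H1Cotangent A' (A' ⊗[A] B) ≃ₗ[A' ⊗[A] B]
      (A' ⊗[A] B) ⊗[B] Algebra.H1Cotangent A B) := by
  let f : (A' ⊗[A] B) ⊗[B] Algebra.H1Cotangent A B →ₗ[A' ⊗[A] B]
      Algebra.H1Cotangent A' (A' ⊗[A] B) :=
    (Algebra.H1Cotangent.map A A' B (A' ⊗[A] B)).liftBaseChange (A' ⊗[A] B)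
  let c := Algebra.IsPushout.cancelBaseChange A A' B (A' ⊗[A] B) (Algebra.H1Cotangent A B)
  let e := Algebra.tensorH1CotangentOfFlat A B A'
  have key : ∀ y : A' ⊗[A] Algebra.H1Cotangent A B, f (c.symm y) = e y := by
    intro y
    induction y with
    | zero => simp only [map_zero]
    | add x y hx hy => simp only [map_add, hx, hy]
    | tmul t x =>
      rw [Algebra.tensorH1CotangentOfFlat_tmul, Algebra.IsPushout.cancelBaseChange_symm_tmul,
        LinearMap.liftBaseChange_tmul, algebraMap_smul]
  have hf : Function.Bijective f := by
    have h : (f : _ → _) = fun x => e (c x) := by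
      funext x
      rw [← key, LinearEquiv.symm_apply_apply]
    rw [h]
    exact e.bijective.comp c.bijective
  exact ⟨(LinearEquiv.ofBijective f hf).symm⟩
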